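/- arXiv:1703.01215 — 2 statements merged into one kernel-verified Lean document; each statement's English description precedes it below -/
import Mathlib

section
/- Let p be an odd prime and α, β ∈ ℤ_p with (α−β+1)_{p−1} ≢ 0 (mod p²). Assume ⟨−α⟩_p is odd and max{⟨−α⟩_p, (p−⟨−α⟩_p)/2} ≤ ⟨−β⟩_p < (p+⟨−α⟩_p)/2. Then ∑_{k=0}^{p−1} (α)_k²(β)_k/((k!)²(α−β+1)_k) ≡ 0 (mod p²), i.e. the truncated series ₃F₂[α, α, β; 1, α−β+1 | 1]_{p−1} has p-adic norm at most p^{−2}. (This is the vanishing case of the p-adic analogue of Dixon's well-poised sum.) -/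
open scoped BigOperators

/-- The Pochhammer symbol `(x)_k = x(x+1)⋯(x+k-1)` in `ℚ_[p]`. -/
noncomputable def poch (p : ℕ) [Fact p.Prime] (x : ℚ_[p]) (k : ℕ) : ℚ_[p] :=
  (ascPochhammer ℚ_[p] k).eval x

/-- The least non-negative residue `⟨α⟩_p ∈ {0,…,p-1}` of `α ∈ ℤ_[p]` modulo `p`. -/
noncomputable def res (p : ℕ) [Fact p.Prime] (α : ℤ_[p]) : ℕ :=
  (PadicInt.toZMod α).val

section Pochhammer

open Polynomial Finset

theorem ascPochhammer_eval_map {R S : Type*} [CommRing R] [CommRing S] (f : R →+* S)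
    (k : ℕ) (x : R) : f ((ascPochhammer R k).eval x) = (ascPochhammer S k).eval (f x) := by
  induction k with
  | zero => simp
  | succ k ih => simp [ascPochhammer_succ_eval, ih]

theorem ascPochhammer_eval_add {R : Type*} [CommRing R] (n m : ℕ) (x : R) :
    (ascPochhammer R (n + m)).eval x =
      (ascPochhammer R n).eval x * (ascPochhammer R m).eval (x + n) := by
  rw [← ascPochhammer_mul]
  simp

theorem ascPochhammer_succ_eval_left {R : Type*} [CommRing R] (n : ℕ) (x : R) :
    (ascPochhammer R (n + 1)).eval x = x * (ascPochhammer R n).eval (x + 1) := by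
  simpa [add_comm] using ascPochhammer_eval_add 1 n x

theorem ascPochhammer_eval_reflect {R : Type*} [CommRing R] (n : ℕ) (x : R) :
    (ascPochhammer R n).eval (1 - x - n) = (-1) ^ n * (ascPochhammer R n).eval x := by
  induction n with
  | zero => simp
  | succ n ih =>
    rw [ascPochhammer_succ_eval_left, ascPochhammer_succ_eval]
    have : 1 - x - ((n + 1 : ℕ) : R) + 1 = 1 - x - n := by push_cast; ring
    rw [this, ih]
    push_cast
    ring

theorem ascPochhammer_eval_neg_natCast {R : Type*} [CommRing R] (n k : ℕ) :
    (ascPochhammer R k).eval (-(n : R)) = (-1) ^ k * (n.descFactorial k : R) := by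
  rw [ascPochhammer_eval_neg_eq_descPochhammer, descPochhammer_eval_eq_descFactorial]

theorem dvd_ascPochhammer_eval {R : Type*} [CommRing R] {d x : R} {a k : ℕ} (hak : a < k)
    (h : d ∣ x + a) : d ∣ (ascPochhammer R k).eval x := by
  obtain ⟨m, rfl⟩ := Nat.exists_eq_add_of_lt hak
  rw [add_assoc, ascPochhammer_eval_add, ascPochhammer_succ_eval_left]
  exact (h.mul_right _).mul_left _

theorem mul_sub_dvd_evalEval_mixed_difference {R : Type*} [CommRing R] (q : R[X][X])
    (x x' y y' : R) :
    (x - x') * (y - y') ∣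
      evalEval x y q - evalEval x y' q - evalEval x' y q + evalEval x' y' q := by
  obtain ⟨h, hh⟩ := sub_dvd_eval_sub (C y) (C y') q
  obtain ⟨g, hg⟩ := sub_dvd_eval_sub x x' h
  refine ⟨g, ?_⟩
  have key (z : R) : evalEval z y q - evalEval z y' q = (y - y') * h.eval z := by
    simpa [evalEval] using congrArg (eval z) hh
  linear_combination key x - key x' + (y - y') * hg

/-- The well-poised sum `₃F₂[x, x, y; 1, x - y + 1 | 1]` truncated after the term of index `n`,
multiplied by `n! ^ 2 * (x - y + 1)_n`. -/
noncomputable def wellPoisedSum {R : Type*} [CommRing R] (n : ℕ) (x y : R) : R :=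
  ∑ k ∈ range (n + 1), (n.descFactorial (n - k) : R) ^ 2 * (ascPochhammer R k).eval x ^ 2 *
    (ascPochhammer R k).eval y * (ascPochhammer R (n - k)).eval (x - y + 1 + k)

theorem map_wellPoisedSum {R S : Type*} [CommRing R] [CommRing S] (f : R →+* S) (n : ℕ)
    (x y : R) : f (wellPoisedSum n x y) = wellPoisedSum n (f x) (f y) := by
  simp [wellPoisedSum, ascPochhammer_eval_map]

theorem mul_sub_dvd_wellPoisedSum {R : Type*} [CommRing R] (n : ℕ) (x x' y y' : R) :
    (x - x') * (y - y') ∣ wellPoisedSum n x y - wellPoisedSum n x y' - wellPoisedSum n x' y +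
      wellPoisedSum n x' y' := by
  have key (z w : R) : evalEval z w (wellPoisedSum n (C X : R[X][X]) X) = wellPoisedSum n z w := by
    have := map_wellPoisedSum (evalEvalRingHom z w) n (C X : R[X][X]) X
    simpa [evalEval] using this
  simpa [key] using
    mul_sub_dvd_evalEval_mixed_difference (wellPoisedSum n (C X : R[X][X]) X) x x' y y'

theorem descFactorial_sub_mul_factorial {n k : ℕ} (h : k ≤ n) :
    k.factorial * n.descFactorial (n - k) = n.factorial := by
  simpa [Nat.sub_sub_self h] using Nat.factorial_mul_descFactorial (Nat.sub_le n k)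

theorem wellPoisedSum_eq_mul_sum {K : Type*} [Field K] [CharZero K] {n : ℕ} {x y : K}
    (h : (ascPochhammer K n).eval (x - y + 1) ≠ 0) :
    wellPoisedSum n x y = (n.factorial : K) ^ 2 * (ascPochhammer K n).eval (x - y + 1) *
      ∑ k ∈ range (n + 1), (ascPochhammer K k).eval x ^ 2 * (ascPochhammer K k).eval y /
        ((k.factorial : K) ^ 2 * (ascPochhammer K k).eval (x - y + 1)) := by
  rw [wellPoisedSum, mul_sum]
  refine sum_congr rfl fun k hk => ?_
  have hkn : k ≤ n := Nat.lt_succ_iff.1 (mem_range.1 hk)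
  have hadd := ascPochhammer_eval_add k (n - k) (x - y + 1)
  rw [Nat.add_sub_cancel' hkn] at hadd
  have hk0 : (ascPochhammer K k).eval (x - y + 1) ≠ 0 := left_ne_zero_of_mul (hadd ▸ h)
  have hf : (k.factorial : K) ≠ 0 := Nat.cast_ne_zero.2 k.factorial_ne_zero
  rw [hadd, ← descFactorial_sub_mul_factorial hkn]
  push_cast
  field_simp

theorem wellPoisedSum_neg_odd {R : Type*} [CommRing R] [IsDomain R] [CharZero R] {a n : ℕ}
    (ha : Odd a) (han : a ≤ n) (y : R) : wellPoisedSum n (-(a : R)) y = 0 := by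
  set u : ℕ → R := fun k => (-1) ^ (a - k) * (a.choose k : R) ^ 2 * (ascPochhammer R k).eval y *
    (ascPochhammer R (a - k)).eval y with hu
  have hsum : wellPoisedSum n (-(a : R)) y = (n.factorial : R) ^ 2 *
      (ascPochhammer R (n - a)).eval (1 - y) * ∑ k ∈ range (a + 1), u k := by
    rw [wellPoisedSum, mul_sum, ← sum_subset (range_mono (Nat.succ_le_succ han))]
    · refine sum_congr rfl fun k hk => ?_
      have hka : k ≤ a := Nat.lt_succ_iff.1 (mem_range.1 hk)
      have hsplit : (ascPochhammer R (n - k)).eval (-(a : R) - y + 1 + k) =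
          (-1) ^ (a - k) * (ascPochhammer R (a - k)).eval y *
            (ascPochhammer R (n - a)).eval (1 - y) := by
        rw [show n - k = (a - k) + (n - a) by omega, ascPochhammer_eval_add,
          ← ascPochhammer_eval_reflect]
        congr 2 <;> push_cast [Nat.cast_sub hka] <;> ring
      have hfac : (n.factorial : R) = k.factorial * n.descFactorial (n - k) := by
        exact_mod_cast (descFactorial_sub_mul_factorial (hka.trans han)).symm
      have hsq : ((-1 : R) ^ k) ^ 2 = 1 := by rw [← pow_mul, mul_comm, pow_mul]; simp
      rw [hsplit, ascPochhammer_eval_neg_natCast, Nat.descFactorial_eq_factorial_mul_choose a k,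
        hfac, hu]
      push_cast
      linear_combination (n.descFactorial (n - k) : R) ^ 2 * (k.factorial * a.choose k) ^ 2 *
        (ascPochhammer R k).eval y * ((-1) ^ (a - k) * (ascPochhammer R (a - k)).eval y *
            (ascPochhammer R (n - a)).eval (1 - y)) * hsq
    · intro k _ hk
      rw [ascPochhammer_eval_neg_natCast, Nat.descFactorial_of_lt (n := a) (by simpa using hk)]
      simp
  have hanti : ∑ k ∈ range (a + 1), u k = -∑ k ∈ range (a + 1), u k := by
    conv_lhs => rw [← sum_flip]
    rw [← sum_neg_distrib]
    refine sum_congr rfl fun k hk => ?_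
    have hka : k ≤ a := Nat.lt_succ_iff.1 (mem_range.1 hk)
    have hsign : (-1 : R) ^ k = -(-1) ^ (a - k) := by
      have h1 : (-1 : R) ^ (a - k) * (-1) ^ k = -1 := by
        rw [← pow_add, Nat.sub_add_cancel hka, ha.neg_one_pow]
      have h2 : (-1 : R) ^ (a - k) * (-1) ^ (a - k) = 1 := by
        rw [← mul_pow]; simp
      linear_combination (-1 : R) ^ (a - k) * h1 - (-1 : R) ^ k * h2
    simp only [hu, Nat.sub_sub_self hka, Nat.choose_symm hka, hsign]
    ring
  rw [hsum, self_eq_neg.1 hanti, mul_zero]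

section Dixon

variable {K : Type*} [Field K] [CharZero K]

/-- The term of index `k` of the terminating sum `₃F₂[x, x, -n; 1, x + n + 1 | 1]`, where
`n = k + m`, multiplied by `(x + n + 1)_n`. -/
noncomputable def dixonTerm (x : K) (k m : ℕ) : K :=
  (-1) ^ k * ((k + m).factorial / (k.factorial ^ 2 * m.factorial)) *
    (ascPochhammer K k).eval x ^ 2 * (ascPochhammer K m).eval (x + 2 * k + m + 1)

/-- The Wilf–Zeilberger companion of `dixonTerm`. -/
noncomputable def dixonCompanion (x : K) (k m : ℕ) : K :=
  (-1) ^ k * ((k + m).factorial / (k.factorial ^ 2 * m.factorial)) *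
    (ascPochhammer K (k + 1)).eval x ^ 2 * (ascPochhammer K m).eval (x + 2 * k + m + 2)

theorem dixonTerm_succ_succ (x : K) (k m : ℕ) :
    (k + m + 2) * dixonTerm x (k + 1) (m + 1) -
      (x + 2 * k + 2 * m + 3) * (2 * k + 2 * m + 4 - x) * dixonTerm x (k + 1) m =
      dixonCompanion x (k + 1) m - dixonCompanion x k (m + 1) := by
  set B := (ascPochhammer K m).eval (x + 2 * k + m + 4) with hB
  have e1 : (ascPochhammer K (m + 1)).eval (x + 2 * (k + 1 : ℕ) + (m + 1 : ℕ) + 1) =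
      B * (x + 2 * k + 2 * m + 4) := by
    rw [ascPochhammer_succ_eval, hB]
    push_cast
    congr 1
    · congr 1; ring
    · ring
  have e2 : (x + 2 * k + 2 * m + 3) *
      (ascPochhammer K m).eval (x + 2 * (k + 1 : ℕ) + m + 1) = (x + 2 * k + m + 3) * B := by
    have h := ascPochhammer_succ_eval m (x + 2 * k + m + 3)
    rw [ascPochhammer_succ_eval_left,
      show x + 2 * k + m + 3 + 1 = x + 2 * k + m + 4 by ring] at h
    rw [hB, h]
    push_cast
    rw [show x + 2 * ((k : K) + 1) + m + 1 = x + 2 * k + m + 3 by ring]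
    ring
  have e3 : (ascPochhammer K m).eval (x + 2 * (k + 1 : ℕ) + m + 2) = B := by
    rw [hB]; push_cast; congr 1; ring
  have e4 : (ascPochhammer K (m + 1)).eval (x + 2 * k + (m + 1 : ℕ) + 2) =
      (x + 2 * k + m + 3) * B := by
    rw [ascPochhammer_succ_eval_left, hB]; push_cast
    congr 1
    · ring
    · congr 1; ring
  have hk : (k.factorial : K) ≠ 0 := Nat.cast_ne_zero.2 k.factorial_ne_zero
  have hm : (m.factorial : K) ≠ 0 := Nat.cast_ne_zero.2 m.factorial_ne_zero
  have hk' : (k : K) + 1 ≠ 0 := Nat.cast_add_one_ne_zero k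
  have hm' : (m : K) + 1 ≠ 0 := Nat.cast_add_one_ne_zero m
  have f1 : ((k + 1 + (m + 1)).factorial : K) = (k + m + 2) * (k + m + 1) * (k + m).factorial := by
    rw [show k + 1 + (m + 1) = k + m + 1 + 1 by ring, Nat.factorial_succ, Nat.factorial_succ]
    push_cast; ring
  have f2 : ((k + 1 + m).factorial : K) = (k + m + 1) * (k + m).factorial := by
    rw [show k + 1 + m = k + m + 1 by ring, Nat.factorial_succ]
    push_cast; ring
  have f3 : ((k + (m + 1)).factorial : K) = (k + m + 1) * (k + m).factorial := by
    rw [← add_assoc, Nat.factorial_succ]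
    push_cast; ring
  have hlin : (x + 2 * k + 2 * m + 3) * (2 * k + 2 * m + 4 - x) * dixonTerm x (k + 1) m =
      (2 * k + 2 * m + 4 - x) * ((-1) ^ (k + 1) * ((k + 1 + m).factorial /
        ((k + 1).factorial ^ 2 * m.factorial)) * (ascPochhammer K (k + 1)).eval x ^ 2 *
          ((x + 2 * k + m + 3) * B)) := by
    rw [← e2, dixonTerm]; ring
  rw [hlin, dixonTerm, dixonCompanion, dixonCompanion, e1, e3, e4, f1, f2, f3,
    ascPochhammer_succ_eval (k + 1) x]
  simp only [Nat.factorial_succ, pow_succ]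
  push_cast
  field_simp
  ring

theorem sum_dixonTerm_succ (x : K) (n : ℕ) :
    (n + 1) * ∑ k ∈ range (n + 2), dixonTerm x k (n + 1 - k) =
      (x + 1 + 2 * n) * (2 * n + 2 - x) * ∑ k ∈ range (n + 1), dixonTerm x k (n - k) := by
  have hn : (n : K) + 1 ≠ 0 := Nat.cast_add_one_ne_zero n
  have hfac : (n.factorial : K) ≠ 0 := Nat.cast_ne_zero.2 n.factorial_ne_zero
  have htel := sum_range_sub (fun k => dixonCompanion x k (n - k)) n
  have hterm : ∑ k ∈ range n,
      (dixonCompanion x (k + 1) (n - (k + 1)) - dixonCompanion x k (n - k)) =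
      (n + 1) * ∑ k ∈ range n, dixonTerm x (k + 1) (n - k) -
        (x + 1 + 2 * n) * (2 * n + 2 - x) * ∑ k ∈ range n, dixonTerm x (k + 1) (n - (k + 1)) := by
    rw [mul_sum, mul_sum, ← sum_sub_distrib]
    refine sum_congr rfl fun k hk => ?_
    obtain ⟨m, rfl⟩ := Nat.exists_eq_add_of_lt (mem_range.1 hk)
    rw [show k + m + 1 - (k + 1) = m by omega, show k + m + 1 - k = m + 1 by omega,
      ← dixonTerm_succ_succ]
    push_cast
    ring
  have hzero : (n + 1) * dixonTerm x 0 (n + 1) -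
      (x + 1 + 2 * n) * (2 * n + 2 - x) * dixonTerm x 0 n = dixonCompanion x 0 n := by
    set B := (ascPochhammer K n).eval (x + n + 2) with hB
    have e1 : (ascPochhammer K (n + 1)).eval (x + 2 * (0 : ℕ) + (n + 1 : ℕ) + 1) =
        B * (x + 2 * n + 2) := by
      rw [ascPochhammer_succ_eval, hB]; push_cast
      congr 1
      · congr 1; ring
      · ring
    have e2 : (x + 1 + 2 * n) * (ascPochhammer K n).eval (x + 2 * (0 : ℕ) + n + 1) =
        (x + n + 1) * B := by
      have h := ascPochhammer_succ_eval n (x + n + 1)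
      rw [ascPochhammer_succ_eval_left, show x + n + 1 + 1 = x + n + 2 by ring] at h
      rw [hB, h]; push_cast
      rw [show x + 2 * 0 + n + 1 = x + n + 1 by ring]
      ring
    have e3 : (ascPochhammer K n).eval (x + 2 * (0 : ℕ) + n + 2) = B := by
      rw [hB]; push_cast; congr 1; ring
    have hlin : (x + 1 + 2 * n) * (2 * n + 2 - x) * dixonTerm x 0 n =
        (2 * n + 2 - x) * ((x + n + 1) * B) := by
      rw [← e2, dixonTerm]; simp [hfac]; ring
    rw [hlin, dixonTerm, dixonCompanion, e1, e3]
    simp [hfac, Nat.factorial_succ, hn]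
    ring
  have hlast : (n + 1) * dixonTerm x (n + 1) 0 = -dixonCompanion x n 0 := by
    rw [dixonTerm, dixonCompanion]
    simp only [Nat.factorial_succ, pow_succ, add_zero]
    push_cast
    simp
    field_simp
  rw [sum_range_succ, sum_range_succ', sum_range_succ' _ n]
  simp only [Nat.sub_zero, Nat.sub_self, Nat.add_sub_add_right] at htel ⊢
  linear_combination hlast + hzero + htel - hterm

theorem factorial_mul_sum_dixonTerm (x : K) (n : ℕ) :
    n.factorial * ∑ k ∈ range (n + 1), dixonTerm x k (n - k) =
      ∏ j ∈ range n, (x + 1 + 2 * j) * (2 * j + 2 - x) := by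
  induction n with
  | zero => simp [dixonTerm]
  | succ n ih =>
    rw [prod_range_succ, ← ih, Nat.factorial_succ]
    push_cast
    linear_combination (n.factorial : K) * sum_dixonTerm_succ x n

theorem wellPoisedSum_neg_self (n : ℕ) (x : K) :
    wellPoisedSum n x (-(n : K)) =
      n.factorial * ∏ j ∈ range n, (x + 1 + 2 * j) * (2 * j + 2 - x) := by
  rw [← factorial_mul_sum_dixonTerm, ← mul_assoc, wellPoisedSum, mul_sum]
  refine sum_congr rfl fun k hk => ?_
  have hkn : k ≤ n := Nat.lt_succ_iff.1 (mem_range.1 hk)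
  have hk0 : (k.factorial : K) ≠ 0 := Nat.cast_ne_zero.2 k.factorial_ne_zero
  have hm0 : ((n - k).factorial : K) ≠ 0 := Nat.cast_ne_zero.2 (n - k).factorial_ne_zero
  have h1 : (n.factorial : K) = k.factorial * n.descFactorial (n - k) := by
    exact_mod_cast (descFactorial_sub_mul_factorial hkn).symm
  have h2 : (n.descFactorial k : K) = n.factorial / (n - k).factorial := by
    rw [eq_div_iff hm0, mul_comm]
    exact_mod_cast Nat.factorial_mul_descFactorial hkn
  have harg : x - -(n : K) + 1 + k = x + 2 * k + (n - k : ℕ) + 1 := by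
    push_cast [Nat.cast_sub hkn]; ring
  rw [ascPochhammer_eval_neg_natCast, h2, harg, dixonTerm, Nat.add_sub_cancel' hkn, h1]
  field_simp

end Dixon

end Pochhammer

section Padic

variable {p : ℕ} [Fact p.Prime]

theorem dvd_add_res_neg (x : ℤ_[p]) : (p : ℤ_[p]) ∣ x + res p (-x) := by
  rw [← Ideal.mem_span_singleton, ← PadicInt.maximalIdeal_eq_span_p, ← PadicInt.ker_toZMod,
    RingHom.mem_ker]
  simp [res]

theorem natCast_dvd_intCast {z : ℤ} : (p : ℤ_[p]) ∣ (z : ℤ_[p]) ↔ (p : ℤ) ∣ z := by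
  rw [← PadicInt.norm_lt_one_iff_dvd, PadicInt.norm_int_lt_one_iff_dvd]

theorem norm_factorial_eq_one {n : ℕ} (hn : n < p) : ‖(n.factorial : ℚ_[p])‖ = 1 := by
  have h : ‖(n.factorial : ℤ_[p])‖ = 1 := by
    rw [PadicInt.norm_natCast_eq_one_iff]
    have hp : p.Prime := Fact.out
    exact hp.coprime_iff_not_dvd.2 fun hd => absurd (hp.dvd_factorial.1 hd) hn.not_ge
  simpa [PadicInt.norm_def] using h

theorem coe_ascPochhammer_eval (k : ℕ) (x : ℤ_[p]) :
    (((ascPochhammer ℤ_[p] k).eval x : ℤ_[p]) : ℚ_[p]) = (ascPochhammer ℚ_[p] k).eval (x : ℚ_[p]) :=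
  ascPochhammer_eval_map (PadicInt.Coe.ringHom (p := p)) k x

theorem norm_ascPochhammer_eval_eq_one {n : ℕ} {x : ℤ_[p]}
    (h : ∀ j < n, ¬ (p : ℤ_[p]) ∣ x + j) : ‖(ascPochhammer ℤ_[p] n).eval x‖ = 1 := by
  induction n with
  | zero => simp
  | succ n ih =>
    rw [ascPochhammer_succ_eval, norm_mul, ih fun j hj => h j (hj.trans n.lt_succ_self),
      one_mul]
    have hn := h n n.lt_succ_self
    rw [← PadicInt.norm_lt_one_iff_dvd, not_lt] at hn
    exact le_antisymm (PadicInt.norm_le_one _) hn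

theorem wellPoisedSum_neg_self_padicInt (n : ℕ) (x : ℤ_[p]) :
    wellPoisedSum n x (-(n : ℤ_[p])) = n.factorial *
      ((∏ j ∈ Finset.range n, (x + 1 + 2 * j)) * ∏ j ∈ Finset.range n, (2 * j + 2 - x)) := by
  have hinj : Function.Injective (PadicInt.Coe.ringHom (p := p)) := Subtype.coe_injective
  apply hinj
  rw [map_wellPoisedSum, map_neg, map_natCast, wellPoisedSum_neg_self,
    ← Finset.prod_mul_distrib]
  simp only [map_mul, map_natCast, map_prod, map_add, map_sub, map_one, map_ofNat]

/-- Under residue conditions on the parameters the well-poised sum vanishes modulo `p ^ 2`. -/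
theorem sq_dvd_wellPoisedSum {a b : ℕ} {α β : ℤ_[p]} (hp : Odd p) (ha : Odd a) (hap : a < p)
    (hα : (p : ℤ_[p]) ∣ α + a) (hβ : (p : ℤ_[p]) ∣ β + b) (hab : a ≤ b) (hpab : p - a ≤ 2 * b) :
    (p : ℤ_[p]) ^ 2 ∣ wellPoisedSum b α β := by
  have hmixed : (p : ℤ_[p]) ^ 2 ∣ _ :=
    (by simpa [sq] using mul_dvd_mul hα hβ : (p : ℤ_[p]) ^ 2 ∣ (α - -a) * (β - -b)).trans
      (mul_sub_dvd_wellPoisedSum b α (-a) β (-b))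
  rw [wellPoisedSum_neg_odd ha hab, wellPoisedSum_neg_odd ha hab, sub_zero, add_zero] at hmixed
  refine (dvd_sub_left ?_).1 hmixed
  rw [wellPoisedSum_neg_self_padicInt, sq]
  refine (mul_dvd_mul ?_ ?_).mul_left _
  · obtain ⟨i, rfl⟩ := ha
    refine Dvd.dvd.trans ?_ (Finset.dvd_prod_of_mem _ (Finset.mem_range.2 (by omega : i < b)))
    convert hα using 1
    push_cast
    ring
  · obtain ⟨i, hi⟩ : ∃ i, p = a + 2 * i + 2 := by
      obtain ⟨c, hc⟩ := hp
      obtain ⟨d, hd⟩ := ha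
      exact ⟨c - d - 1, by omega⟩
    refine Dvd.dvd.trans ?_ (Finset.dvd_prod_of_mem _ (Finset.mem_range.2 (by omega : i < b)))
    have hpi : (p : ℤ_[p]) = a + 2 * i + 2 := by exact_mod_cast congrArg (Nat.cast (R := ℤ_[p])) hi
    have : (2 * i + 2 - α : ℤ_[p]) = p - (α + a) := by rw [hpi]; ring
    rw [this]
    exact dvd_sub_self_left.2 hα

theorem norm_le_zpow_neg_of_pow_dvd {x : ℤ_[p]} {n : ℕ} (h : (p : ℤ_[p]) ^ n ∣ x) :
    ‖(x : ℚ_[p])‖ ≤ (p : ℝ) ^ (-n : ℤ) := by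
  rw [PadicInt.padic_norm_e_of_padicInt, PadicInt.norm_le_pow_iff_mem_span_pow]
  exact Ideal.mem_span_singleton.2 h

theorem zpow_neg_le_norm_of_not_pow_succ_dvd {x : ℤ_[p]} {n : ℕ}
    (h : ¬ (p : ℤ_[p]) ^ (n + 1) ∣ x) : (p : ℝ) ^ (-n : ℤ) ≤ ‖(x : ℚ_[p])‖ := by
  rw [← Ideal.mem_span_singleton, ← PadicInt.norm_le_pow_iff_mem_span_pow,
    PadicInt.norm_le_pow_iff_norm_lt_pow_add_one, not_lt] at h
  simpa using h

end Padic

/-- Vanishing case of the p-adic analogue of Dixon's well-poised sum: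
`₃F₂[α,α,β;1,α−β+1|1]_{p−1} ≡ 0 (mod p²)`. -/
theorem padic_dixon_vanishing
    (p : ℕ) [Fact p.Prime] (hp : Odd p) (α β : ℤ_[p])
    (hpoch : ¬ ((p : ℤ_[p]) ^ 2 ∣ (ascPochhammer ℤ_[p] (p - 1)).eval (α - β + 1)))
    (ha : Odd (res p (-α)))
    (h1 : res p (-α) ≤ res p (-β))
    (h2 : p - res p (-α) ≤ 2 * res p (-β))
    (h3 : 2 * res p (-β) < p + res p (-α)) :
    ‖∑ k ∈ Finset.range p,
        poch p (α : ℚ_[p]) k ^ 2 * poch p (β : ℚ_[p]) k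
          / ((Nat.factorial k : ℚ_[p]) ^ 2 * poch p ((α : ℚ_[p]) - (β : ℚ_[p]) + 1) k)‖
      ≤ (p : ℝ) ^ (-2 : ℤ) := by
  set a := res p (-α) with ha_def
  set b := res p (-β) with hb_def
  have hprime : p.Prime := Fact.out
  have hap : a < p := ZMod.val_lt _
  have hbp : b < p := ZMod.val_lt _
  have hα : (p : ℤ_[p]) ∣ α + a := dvd_add_res_neg α
  have hβ : (p : ℤ_[p]) ∣ β + b := dvd_add_res_neg β
  have hp0 : (0 : ℝ) < p := Nat.cast_pos.2 hprime.pos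
  have hcoe : (α : ℚ_[p]) - (β : ℚ_[p]) + 1 = ((α - β + 1 : ℤ_[p]) : ℚ_[p]) := by push_cast; ring
  simp only [poch, hcoe]
  rw [← Finset.sum_range_add_sum_Ico _ (Nat.succ_le_of_lt hbp)]
  refine (IsUltrametricDist.norm_add_le_max _ _).trans (max_le ?_ ?_)
  · have hunit : ‖(ascPochhammer ℤ_[p] b).eval (α - β + 1)‖ = 1 := by
      refine norm_ascPochhammer_eval_eq_one fun j hj hd => ?_
      have hz : (p : ℤ_[p]) ∣ ((b - a + 1 + j : ℤ) : ℤ_[p]) := by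
        have := (hd.sub hα).add hβ
        push_cast
        convert this using 1
        ring
      have := Int.le_of_dvd (by omega) (natCast_dvd_intCast.1 hz)
      omega
    have hunit' : ‖(ascPochhammer ℚ_[p] b).eval ((α - β + 1 : ℤ_[p]) : ℚ_[p])‖ = 1 := by
      rw [← coe_ascPochhammer_eval, PadicInt.padic_norm_e_of_padicInt, hunit]
    have hne : (ascPochhammer ℚ_[p] b).eval ((α : ℚ_[p]) - β + 1) ≠ 0 := by
      rw [hcoe, ← norm_ne_zero_iff, hunit']
      exact one_ne_zero
    have hnorm := congrArg norm (wellPoisedSum_eq_mul_sum hne)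
    rw [hcoe, norm_mul, norm_mul, norm_pow, norm_factorial_eq_one hbp, hunit', one_pow, one_mul,
      one_mul] at hnorm
    refine hnorm.symm.le.trans ?_
    have hmap := map_wellPoisedSum (PadicInt.Coe.ringHom (p := p)) b α β
    exact (congrArg norm hmap).symm.le.trans
      (norm_le_zpow_neg_of_pow_dvd (sq_dvd_wellPoisedSum hp ha hap hα hβ h1 h2))
  · refine IsUltrametricDist.norm_sum_le_of_forall_le_of_nonneg (by positivity) fun k hk => ?_
    obtain ⟨hbk, hkp⟩ := Finset.mem_Ico.1 hk
    have hnα := norm_le_zpow_neg_of_pow_dvd (n := 1)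
      (by simpa using dvd_ascPochhammer_eval (by omega : a < k) hα)
    have hnβ := norm_le_zpow_neg_of_pow_dvd (n := 1)
      (by simpa using dvd_ascPochhammer_eval (by omega : b < k) hβ)
    have hden := zpow_neg_le_norm_of_not_pow_succ_dvd (n := 1)
      (x := (ascPochhammer ℤ_[p] k).eval (α - β + 1)) fun hd => hpoch <| by
        rw [show p - 1 = k + (p - 1 - k) by omega, ascPochhammer_eval_add]
        exact hd.mul_right _
    rw [coe_ascPochhammer_eval] at hnα hnβ hden
    rw [norm_div, norm_mul, norm_mul, norm_pow, norm_pow, norm_factorial_eq_one hkp, one_pow,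
      one_mul]
    have hpos : (0 : ℝ) < (p : ℝ) ^ (-(1 : ℕ) : ℤ) := by positivity
    rw [div_le_iff₀ (hpos.trans_le hden)]
    calc _ ≤ ((p : ℝ) ^ (-(1 : ℕ) : ℤ)) ^ 2 * (p : ℝ) ^ (-(1 : ℕ) : ℤ) := by gcongr
      _ = (p : ℝ) ^ (-2 : ℤ) * (p : ℝ) ^ (-(1 : ℕ) : ℤ) := by
        rw [← zpow_natCast, ← zpow_mul]; norm_num
      _ ≤ _ := by gcongr
end

section
/- Let p be an odd prime, α ∈ ℤ_p^×, and β, γ, δ, ε ∈ ℤ_p. Set ρ = δ + ε − α − β − γ. Assume: (i) ⟨−α⟩_p ≤ min{⟨−δ⟩_p, ⟨−ε⟩_p}, ⟨−β⟩_p ≤ ⟨−δ⟩_p, and ⟨−γ⟩_p ≤ ⟨−ε⟩_p; (ii) ⟨−α⟩_p + ⟨−β⟩_p + ⟨−γ⟩_p ≥ p + max{⟨−δ⟩_p, ⟨−ε⟩_p}; (iii) (δ)_{p−1} ≢ 0 (mod p²) and (ε)_{p−1} ≢ 0 (mod p²). Then ∑_{k=0}^{p−1} (ρ)_k(α)_k(β)_k(γ)_k/((k!)²(δ)_k(ε)_k)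 ≡ 0 (mod p²), i.e. the truncated series ₄F₃[ρ, α, β, γ; 1, δ, ε | 1]_{p−1} has p-adic norm at most p^{−2}. -/
open scoped BigOperators

open Finset Polynomial

/-- The rising product `∏ (x + i)` over `i < k`, in an arbitrary commutative ring. -/
def risingProd {R : Type*} [CommRing R] (x : R) (k : ℕ) : R := ∏ i ∈ range k, (x + i)

/-- The product `∏ (x + i)` over `k ≤ i < m`. -/
def risingTail {R : Type*} [CommRing R] (x : R) (k m : ℕ) : R := ∏ i ∈ Ico k m, (x + i)

lemma ascPochhammer_eval_eq_risingProd {R : Type*} [CommRing R] (x : R) (k : ℕ) :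
    (ascPochhammer R k).eval x = risingProd x k := by
  induction k with
  | zero => simp [risingProd]
  | succ k ih => rw [ascPochhammer_succ_eval, ih, risingProd, risingProd, prod_range_succ]

lemma risingProd_one {R : Type*} [CommRing R] (k : ℕ) :
    risingProd (1 : R) k = (k.factorial : R) := by
  rw [← ascPochhammer_eval_eq_risingProd, ascPochhammer_eval_one]

lemma risingProd_mul_risingTail {R : Type*} [CommRing R] (x : R) {k m : ℕ} (h : k ≤ m) :
    risingProd x k * risingTail x k m = risingProd x m :=
  prod_range_mul_prod_Ico _ h

lemma risingProd_dvd {R : Type*} [CommRing R] (x : R) {k m : ℕ} (h : k ≤ m) :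
    risingProd x k ∣ risingProd x m :=
  ⟨_, (risingProd_mul_risingTail x h).symm⟩

lemma risingProd_add {R : Type*} [CommRing R] (x : R) (s t : ℕ) :
    risingProd x (s + t) = risingProd x s * risingProd (x + s) t := by
  simp [risingProd, prod_range_add, add_assoc]

lemma map_risingProd {R S : Type*} [CommRing R] [CommRing S] (f : R →+* S) (x : R) (k : ℕ) :
    f (risingProd x k) = risingProd (f x) k := by
  simp [risingProd, map_prod]

lemma map_risingTail {R S : Type*} [CommRing R] [CommRing S] (f : R →+* S) (x : R) (k m : ℕ) :
    f (risingTail x k m) = risingTail (f x) k m := by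
  simp [risingTail, map_prod]

lemma risingProd_neg_natCast {K : Type*} [Field K] [CharZero K] (n k : ℕ) :
    risingProd (-(n : K)) k = (-1) ^ k * n.choose k * k.factorial := by
  induction k with
  | zero => simp [risingProd]
  | succ k ih =>
    rw [risingProd, prod_range_succ, ← risingProd, ih]
    have h := congrArg (Nat.cast (R := K)) (Nat.choose_succ_right_eq n k)
    rcases le_or_gt k n with hk | hk
    · push_cast [Nat.cast_sub hk] at h
      rw [Nat.factorial_succ, pow_succ]
      push_cast
      linear_combination (-1) ^ k * (k.factorial : K) * h
    · simp [Nat.choose_eq_zero_of_lt hk, Nat.choose_eq_zero_of_lt (hk.trans (Nat.lt_succ_self k))]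

lemma sum_neg_one_pow_mul_choose_mul_eval {K : Type*} [Field K] {n m : ℕ} (hnm : n ≤ m)
    {Q : K[X]} (hQ : Q.natDegree < n) :
    ∑ k ∈ range (m + 1), (-1) ^ k * (n.choose k : K) * Q.eval (k : K) = 0 := by
  rw [← sum_subset (range_mono (Nat.succ_le_succ hnm)) fun k _ hk => by
    rw [Nat.choose_eq_zero_of_lt (by simpa using hk)]; simp]
  have h := congrFun (Polynomial.fwdDiff_iter_eq_zero_of_degree_lt hQ) 0
  rw [fwdDiff_iter_eq_sum_shift] at h
  simp only [zero_add, nsmul_eq_mul, mul_one, zsmul_eq_mul, Pi.zero_apply] at h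
  have h_cast := congrArg (fun x => (-1 : K) ^ n * x) h
  simp only [mul_zero, mul_sum] at h_cast
  rw [← h_cast]
  refine sum_congr rfl fun k hk => ?_
  have hkn : k ≤ n := Nat.lt_succ_iff.mp (mem_range.mp hk)
  obtain ⟨j, rfl⟩ := Nat.exists_eq_add_of_le hkn
  have hj : (-1 : K) ^ j * (-1) ^ j = 1 := by rw [← mul_pow]; simp
  push_cast
  rw [Nat.add_sub_cancel_left, pow_add]
  linear_combination (-((-1) ^ k * ((k + j).choose k : K) * Q.eval (k : K))) * hj

lemma risingProd_ratio {K : Type*} [Field K] {A B : K} {t k : ℕ} (hA : A = B + t)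
    (ht : risingProd B t ≠ 0) (hk : risingProd B k ≠ 0) :
    risingProd A k / risingProd B k = risingProd (B + k) t / risingProd B t := by
  rw [div_eq_div_iff hk ht, hA, mul_comm, ← risingProd_add, mul_comm, ← risingProd_add, add_comm]

lemma exists_polynomial_risingProd {K : Type*} [Field K] (B : K) (t : ℕ) :
    ∃ Q : K[X], Q.natDegree ≤ t ∧ ∀ k : ℕ, Q.eval (k : K) = risingProd (B + k) t := by
  refine ⟨∏ i ∈ range t, (X + C (B + i)), ?_, fun k => ?_⟩
  · exact (natDegree_prod_le _ _).trans
      ((sum_le_card_nsmul (range t) _ 1 fun i _ => (natDegree_X_add_C (B + (i : K))).le).trans_eq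
        (by rw [card_range, smul_eq_mul, mul_one]))
  · simp only [eval_prod, eval_add, eval_X, eval_C, risingProd]
    exact prod_congr rfl fun i _ => by ring

lemma sum_risingProd_eq_zero {K : Type*} [Field K] [CharZero K] {n m t₁ t₂ t₃ : ℕ}
    {N A₁ A₂ A₃ B₁ B₂ B₃ : K} (hN : N = -(n : K)) (hnm : n ≤ m) (ht : t₁ + t₂ + t₃ < n)
    (h₁ : A₁ = B₁ + t₁) (h₂ : A₂ = B₂ + t₂) (h₃ : A₃ = B₃ + t₃)
    (ht₁ : risingProd B₁ t₁ ≠ 0) (ht₂ : risingProd B₂ t₂ ≠ 0) (ht₃ : risingProd B₃ t₃ ≠ 0)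
    (hm₁ : risingProd B₁ m ≠ 0) (hm₂ : risingProd B₂ m ≠ 0) (hm₃ : risingProd B₃ m ≠ 0) :
    ∑ k ∈ range (m + 1), risingProd N k * risingProd A₁ k * risingProd A₂ k * risingProd A₃ k /
      (risingProd 1 k * risingProd B₁ k * risingProd B₂ k * risingProd B₃ k) = 0 := by
  obtain ⟨Q₁, hQ₁, e₁⟩ := exists_polynomial_risingProd B₁ t₁
  obtain ⟨Q₂, hQ₂, e₂⟩ := exists_polynomial_risingProd B₂ t₂
  obtain ⟨Q₃, hQ₃, e₃⟩ := exists_polynomial_risingProd B₃ t₃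
  have hdeg : (Q₁ * Q₂ * Q₃).natDegree < n := by
    have := natDegree_mul_le (p := Q₁ * Q₂) (q := Q₃)
    have := natDegree_mul_le (p := Q₁) (q := Q₂)
    omega
  have h := sum_neg_one_pow_mul_choose_mul_eval hnm hdeg
  rw [← mul_zero (risingProd B₁ t₁ * risingProd B₂ t₂ * risingProd B₃ t₃)⁻¹, ← h, mul_sum]
  refine sum_congr rfl fun k hk => ?_
  have hkm : k ≤ m := Nat.lt_succ_iff.mp (mem_range.mp hk)
  have r₁ := risingProd_ratio h₁ ht₁ (ne_zero_of_dvd_ne_zero hm₁ (risingProd_dvd B₁ hkm))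
  have r₂ := risingProd_ratio h₂ ht₂ (ne_zero_of_dvd_ne_zero hm₂ (risingProd_dvd B₂ hkm))
  have r₃ := risingProd_ratio h₃ ht₃ (ne_zero_of_dvd_ne_zero hm₃ (risingProd_dvd B₃ hkm))
  have r₀ : risingProd N k / risingProd 1 k = (-1) ^ k * (n.choose k : K) := by
    rw [hN, risingProd_neg_natCast, risingProd_one,
      mul_div_cancel_right₀ _ (Nat.cast_ne_zero.mpr k.factorial_ne_zero)]
  calc _ = (risingProd N k / risingProd 1 k) * (risingProd A₁ k / risingProd B₁ k) *
        (risingProd A₂ k / risingProd B₂ k) * (risingProd A₃ k / risingProd B₃ k) := by ring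
    _ = _ := by
      rw [r₀, r₁, r₂, r₃, eval_mul, eval_mul, e₁, e₂, e₃]
      ring

lemma risingProd_natCast_ne_zero {K : Type*} [Field K] [CharZero K] {n : ℕ} (hn : 0 < n) (k : ℕ) :
    risingProd (n : K) k ≠ 0 :=
  prod_ne_zero_iff.mpr fun i _ => by exact_mod_cast (Nat.add_pos_left hn i).ne'

lemma risingProd_neg_natCast_ne_zero {K : Type*} [Field K] [CharZero K] {n k : ℕ} (hk : k ≤ n) :
    risingProd (-(n : K)) k ≠ 0 := by
  rw [risingProd_neg_natCast]
  have := (Nat.choose_pos hk).ne'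
  have := k.factorial_ne_zero
  simp_all

/-- The balanced series `₄F₃[δ+ε-α-β-γ, α, β, γ; 1, δ, ε | 1]_m` multiplied by
its common denominator `(m!)² (δ)_m (ε)_m`. -/
def clearedSum {R : Type*} [CommRing R] (m : ℕ) (α β γ δ ε : R) : R :=
  ∑ k ∈ range (m + 1), risingProd (δ + ε - α - β - γ) k * risingProd α k * risingProd β k *
    risingProd γ k * (risingTail 1 k m ^ 2 * risingTail δ k m * risingTail ε k m)

lemma map_clearedSum {R S : Type*} [CommRing R] [CommRing S] (f : R →+* S) (m : ℕ)
    (α β γ δ ε : R) :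
    f (clearedSum m α β γ δ ε) = clearedSum m (f α) (f β) (f γ) (f δ) (f ε) := by
  simp [clearedSum, map_sum, map_risingProd, map_risingTail]

lemma clearedSum_mem {R : Type*} [CommRing R] (S : Subring R) (m : ℕ) {α β γ δ ε : R}
    (hα : α ∈ S) (hβ : β ∈ S) (hγ : γ ∈ S) (hδ : δ ∈ S) (hε : ε ∈ S) :
    clearedSum m α β γ δ ε ∈ S := by
  have hP : ∀ {x : R}, x ∈ S → ∀ k, risingProd x k ∈ S := fun hx k =>
    S.prod_mem fun i _ => S.add_mem hx (natCast_mem S i)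
  have hT : ∀ {x : R}, x ∈ S → ∀ k, risingTail x k m ∈ S := fun hx k =>
    S.prod_mem fun i _ => S.add_mem hx (natCast_mem S i)
  have hρ : δ + ε - α - β - γ ∈ S :=
    S.sub_mem (S.sub_mem (S.sub_mem (S.add_mem hδ hε) hα) hβ) hγ
  exact S.sum_mem fun k _ => S.mul_mem
    (S.mul_mem (S.mul_mem (S.mul_mem (hP hρ k) (hP hα k)) (hP hβ k)) (hP hγ k))
    (S.mul_mem (S.mul_mem (S.pow_mem (hT S.one_mem k) 2) (hT hδ k)) (hT hε k))

lemma clearedSum_eq {K : Type*} [Field K] [CharZero K] {m : ℕ} {α β γ δ ε : K}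
    (hδ : risingProd δ m ≠ 0) (hε : risingProd ε m ≠ 0) :
    clearedSum m α β γ δ ε = risingProd 1 m ^ 2 * risingProd δ m * risingProd ε m *
      ∑ k ∈ range (m + 1), risingProd (δ + ε - α - β - γ) k * risingProd α k * risingProd β k *
        risingProd γ k / (risingProd 1 k ^ 2 * risingProd δ k * risingProd ε k) := by
  rw [clearedSum, mul_sum]
  refine sum_congr rfl fun k hk => ?_
  have hkm : k ≤ m := Nat.lt_succ_iff.mp (mem_range.mp hk)
  have h1 : risingProd (1 : K) k ≠ 0 := by
    rw [risingProd_one]; exact_mod_cast k.factorial_ne_zero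
  have hδk := ne_zero_of_dvd_ne_zero hδ (risingProd_dvd δ hkm)
  have hεk := ne_zero_of_dvd_ne_zero hε (risingProd_dvd ε hkm)
  rw [← risingProd_mul_risingTail (1 : K) hkm, ← risingProd_mul_risingTail δ hkm,
    ← risingProd_mul_risingTail ε hkm]
  field_simp

/-- Functions on `V` that agree with an affine function with linear part divisible by `π`,
modulo `π²`. -/
def affineModSq {R : Type*} [CommRing R] (π : R) (V : Type*) [AddCommGroup V] [Module R V] :
    Subring (V → R) where
  carrier := {f | ∃ (c : R) (l : V →ₗ[R] R), ∀ v, π ^ 2 ∣ f v - (c + π * l v)}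
  zero_mem' := ⟨0, 0, by simp⟩
  one_mem' := ⟨1, 0, by simp⟩
  add_mem' := by
    rintro f g ⟨c, l, hf⟩ ⟨c₂, l₂, hg⟩
    refine ⟨c + c₂, l + l₂, fun v => (dvd_add (hf v) (hg v)).trans (dvd_of_eq ?_)⟩
    simp only [Pi.add_apply, LinearMap.add_apply]
    ring
  neg_mem' := by
    rintro f ⟨c, l, hf⟩
    refine ⟨-c, -l, fun v => ((dvd_neg.mpr (hf v))).trans (dvd_of_eq ?_)⟩
    simp only [Pi.neg_apply, LinearMap.neg_apply]
    ring
  mul_mem' := by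
    rintro f g ⟨c, l, hf⟩ ⟨c₂, l₂, hg⟩
    refine ⟨c * c₂, c • l₂ + c₂ • l, fun v => ?_⟩
    obtain ⟨s, hs⟩ := hf v
    obtain ⟨s₂, hs₂⟩ := hg v
    refine ⟨s * g v + (c + π * l v) * s₂ + l v * l₂ v, ?_⟩
    simp only [Pi.mul_apply, LinearMap.add_apply, LinearMap.smul_apply, smul_eq_mul]
    linear_combination g v * hs + (c + π * l v) * hs₂

lemma exists_submodule_of_mem_affineModSq {R V : Type*} [CommRing R] {π : R} [AddCommGroup V]
    [Module R V] {f : V → R} (hf : f ∈ affineModSq π V) (h0 : π ^ 2 ∣ f 0) :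
    ∃ S : Submodule R V, ∀ v, v ∈ S ↔ π ^ 2 ∣ f v := by
  obtain ⟨c, l, h⟩ := hf
  have hc : π ^ 2 ∣ c := by
    have := h 0
    rw [map_zero, mul_zero, add_zero] at this
    exact (dvd_sub_right h0).mp this
  refine ⟨Submodule.comap (π • l) (Ideal.span {π ^ 2}), fun v => ?_⟩
  rw [Submodule.mem_comap, LinearMap.smul_apply, smul_eq_mul, Ideal.mem_span_singleton,
    ← dvd_add_right hc]
  exact (dvd_iff_dvd_of_dvd_sub (h v)).symm

lemma dvd_of_mem_affineModSq {R : Type*} [CommRing R] {π : R} {f : (Fin 5 → R) → R}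
    (hf : f ∈ affineModSq π (Fin 5 → R))
    (h₀ : f 0 = 0) (h₁ : f ![0, 1, 0, 1, 0] = 0) (h₂ : f ![0, 0, 1, 0, 1] = 0)
    (h₃ : f ![0, 1, 0, 0, 0] = 0) (h₄ : f ![0, 0, 1, 0, 0] = 0) (h₅ : f ![1, 1, 0, 1, 0] = 0)
    (v : Fin 5 → R) : π ^ 2 ∣ f v := by
  obtain ⟨S, hS⟩ := exists_submodule_of_mem_affineModSq hf (h₀ ▸ dvd_zero _)
  have mem {u : Fin 5 → R} (hu : f u = 0) : u ∈ S := (hS u).mpr (hu ▸ dvd_zero _)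
  have hv : v = v 0 • (![1, 1, 0, 1, 0] - ![0, 1, 0, 1, 0]) + v 1 • ![0, 1, 0, 0, 0] +
      v 2 • ![0, 0, 1, 0, 0] + v 3 • (![0, 1, 0, 1, 0] - ![0, 1, 0, 0, 0]) +
      v 4 • (![0, 0, 1, 0, 1] - ![0, 0, 1, 0, 0]) := by
    ext i
    fin_cases i <;> simp
  rw [← hS, hv]
  exact S.add_mem (S.add_mem (S.add_mem (S.add_mem
    (S.smul_mem _ (S.sub_mem (mem h₅) (mem h₁))) (S.smul_mem _ (mem h₃)))
    (S.smul_mem _ (mem h₄))) (S.smul_mem _ (S.sub_mem (mem h₁) (mem h₃))))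
    (S.smul_mem _ (S.sub_mem (mem h₂) (mem h₄)))

section Points

variable {K : Type*} [Field K] [CharZero K]

/-- `clearedSum` vanishes as soon as the series it clears does. -/
lemma clearedSum_eq_zero {m : ℕ} {ρ α β γ δ ε : K} (hρ : ρ = δ + ε - α - β - γ)
    (hδ : risingProd δ m ≠ 0) (hε : risingProd ε m ≠ 0)
    (h : ∑ k ∈ range (m + 1), risingProd ρ k * risingProd α k * risingProd β k *
        risingProd γ k / (risingProd 1 k ^ 2 * risingProd δ k * risingProd ε k) = 0) :
    clearedSum m α β γ δ ε = 0 := by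
  rw [clearedSum_eq hδ hε, ← hρ, h, mul_zero]

lemma risingProd_one_ne_zero (k : ℕ) : risingProd (1 : K) k ≠ 0 := by
  rw [risingProd_one]
  exact_mod_cast k.factorial_ne_zero

/-- The cleared sum vanishes when `α = -a` terminates the series and the remaining upper
parameters exceed lower parameters by natural numbers, paired as `β, δ`, `γ, ε` and `ρ, 1`. -/
lemma clearedSum_eq_zero_of_pair_rho {m a t₁ t₂ t₃ : ℕ} {α β γ δ ε : K} (hα : α = -(a : K))
    (ham : a ≤ m) (ht : t₁ + t₂ + t₃ < a) (h₁ : β = δ + t₁) (h₂ : γ = ε + t₂)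
    (h₃ : δ + ε - α - β - γ = 1 + t₃)
    (ht₁ : risingProd δ t₁ ≠ 0) (ht₂ : risingProd ε t₂ ≠ 0)
    (hδ : risingProd δ m ≠ 0) (hε : risingProd ε m ≠ 0) :
    clearedSum m α β γ δ ε = 0 := by
  refine clearedSum_eq_zero rfl hδ hε ?_
  rw [← sum_risingProd_eq_zero hα ham ht h₁ h₂ h₃ ht₁ ht₂ (risingProd_one_ne_zero _) hδ hε
    (risingProd_one_ne_zero _)]
  exact sum_congr rfl fun k _ => by ring

/-- As `clearedSum_eq_zero_of_pair_rho`, with the pairs `ρ, δ`, `γ, ε` and `β, 1`. -/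
lemma clearedSum_eq_zero_of_pair_beta {m a t₁ t₂ t₃ : ℕ} {α β γ δ ε : K} (hα : α = -(a : K))
    (ham : a ≤ m) (ht : t₁ + t₂ + t₃ < a) (h₁ : δ + ε - α - β - γ = δ + t₁) (h₂ : γ = ε + t₂)
    (h₃ : β = 1 + t₃)
    (ht₁ : risingProd δ t₁ ≠ 0) (ht₂ : risingProd ε t₂ ≠ 0)
    (hδ : risingProd δ m ≠ 0) (hε : risingProd ε m ≠ 0) :
    clearedSum m α β γ δ ε = 0 := by
  refine clearedSum_eq_zero rfl hδ hε ?_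
  rw [← sum_risingProd_eq_zero hα ham ht h₁ h₂ h₃ ht₁ ht₂ (risingProd_one_ne_zero _) hδ hε
    (risingProd_one_ne_zero _)]
  exact sum_congr rfl fun k _ => by ring

/-- As `clearedSum_eq_zero_of_pair_rho`, with the pairs `ρ, ε`, `β, δ` and `γ, 1`. -/
lemma clearedSum_eq_zero_of_pair_gamma {m a t₁ t₂ t₃ : ℕ} {α β γ δ ε : K} (hα : α = -(a : K))
    (ham : a ≤ m) (ht : t₁ + t₂ + t₃ < a) (h₁ : δ + ε - α - β - γ = ε + t₁) (h₂ : β = δ + t₂)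
    (h₃ : γ = 1 + t₃)
    (ht₁ : risingProd ε t₁ ≠ 0) (ht₂ : risingProd δ t₂ ≠ 0)
    (hδ : risingProd δ m ≠ 0) (hε : risingProd ε m ≠ 0) :
    clearedSum m α β γ δ ε = 0 := by
  refine clearedSum_eq_zero rfl hδ hε ?_
  rw [← sum_risingProd_eq_zero hα ham ht h₁ h₂ h₃ ht₁ ht₂ (risingProd_one_ne_zero _) hε hδ
    (risingProd_one_ne_zero _)]
  exact sum_congr rfl fun k _ => by ring

/-- The cleared sum vanishes when `ρ = -r` terminates the series, with the pairs `α, δ`,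
`γ, ε` and `β, 1`. -/
lemma clearedSum_eq_zero_of_rho_eq_neg {m r t₁ t₂ t₃ : ℕ} {α β γ δ ε : K}
    (hρ : δ + ε - α - β - γ = -(r : K))
    (hrm : r ≤ m) (ht : t₁ + t₂ + t₃ < r) (h₁ : α = δ + t₁) (h₂ : γ = ε + t₂)
    (h₃ : β = 1 + t₃)
    (ht₁ : risingProd δ t₁ ≠ 0) (ht₂ : risingProd ε t₂ ≠ 0)
    (hδ : risingProd δ m ≠ 0) (hε : risingProd ε m ≠ 0) :
    clearedSum m α β γ δ ε = 0 := by
  refine clearedSum_eq_zero rfl hδ hε ?_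
  rw [← sum_risingProd_eq_zero hρ hrm ht h₁ h₂ h₃ ht₁ ht₂ (risingProd_one_ne_zero _) hδ hε
    (risingProd_one_ne_zero _)]
  exact sum_congr rfl fun k _ => by ring

end Points

section Padic

variable {p : ℕ} [Fact p.Prime]

lemma res_lt (x : ℤ_[p]) : res p x < p := ZMod.val_lt _

lemma exists_eq_neg_res_add (x : ℤ_[p]) :
    ∃ y : ℤ_[p], x = -(res p (-x) : ℤ_[p]) + p * y := by
  have h : PadicInt.toZMod (x + (res p (-x) : ℤ_[p])) = 0 := by
    rw [map_add, map_natCast, res, ZMod.natCast_zmod_val, map_neg, add_neg_cancel]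
  rw [← RingHom.mem_ker, PadicInt.ker_toZMod, PadicInt.maximalIdeal_eq_span_p,
    Ideal.mem_span_singleton] at h
  obtain ⟨y, hy⟩ := h
  exact ⟨y, by linear_combination hy⟩

lemma isUnit_of_not_dvd {x : ℤ_[p]} (h : ¬ (p : ℤ_[p]) ∣ x) : IsUnit x := by
  by_contra hx
  exact h ((PadicInt.norm_lt_one_iff_dvd x).mp (PadicInt.not_isUnit_iff.mp hx))

lemma natCast_dvd_risingProd {x y : ℤ_[p]} {n k : ℕ} (hx : x = -(n : ℤ_[p]) + p * y) (hk : n < k) :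
    (p : ℤ_[p]) ∣ risingProd x k :=
  (Dvd.intro y (by rw [hx]; ring : (p : ℤ_[p]) * y = x + n)).trans
    (dvd_prod_of_mem (fun i : ℕ => x + (i : ℤ_[p])) (mem_range.mpr hk))

lemma isUnit_risingProd {x y : ℤ_[p]} {n k : ℕ} (hx : x = -(n : ℤ_[p]) + p * y) (hn : n < p)
    (hk : k ≤ n) : IsUnit (risingProd x k) := by
  refine isUnit_of_not_dvd fun h => ?_
  obtain ⟨i, hi, hdvd⟩ := (PadicInt.prime_p.dvd_finsetProd_iff _).mp h
  have hik : i < k := mem_range.mp hi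
  have h_cast : (p : ℤ_[p]) ∣ ((n - i : ℕ) : ℤ_[p]) := by
    have e : ((n - i : ℕ) : ℤ_[p]) = p * y - (x + i) := by
      rw [Nat.cast_sub (hik.le.trans hk), hx]; ring
    rw [e]
    exact dvd_sub (dvd_mul_right _ _) hdvd
  have h_dvd_nat : p ∣ n - i := by
    have := (PadicInt.norm_int_lt_one_iff_dvd (p := p) ((n - i : ℕ) : ℤ)).mp (by
      rw [PadicInt.norm_lt_one_iff_dvd]; exact_mod_cast h_cast)
    exact_mod_cast this
  have := Nat.le_of_dvd (by omega) h_dvd_nat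
  omega

lemma isUnit_risingProd_one {k : ℕ} (hk : k < p) : IsUnit (risingProd (1 : ℤ_[p]) k) :=
  isUnit_risingProd (n := p - 1) (y := 1)
    (by rw [Nat.cast_sub (Fact.out : p.Prime).one_lt.le]; simp)
    (Nat.sub_lt (Fact.out : p.Prime).pos one_pos) (Nat.le_sub_one_of_lt hk)

/-- The vanishing at six parameter points and affinity modulo `p²` give the vanishing of the
cleared sum modulo `p²`. -/
lemma sq_dvd_clearedSum {a b c d e : ℕ} {α β γ δ ε x y z u w : ℤ_[p]}
    (hα : α = -(a : ℤ_[p]) + p * x) (hβ : β = -(b : ℤ_[p]) + p * y)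
    (hγ : γ = -(c : ℤ_[p]) + p * z) (hδ : δ = -(d : ℤ_[p]) + p * u)
    (hε : ε = -(e : ℤ_[p]) + p * w) (hb : b < p) (hc : c < p) (hd : d < p) (he : e < p)
    (had : a ≤ d) (hae : a ≤ e) (hbd : b ≤ d) (hce : c ≤ e) (h : p + max d e ≤ a + b + c) :
    (p : ℤ_[p]) ^ 2 ∣ clearedSum (min d e) α β γ δ ε := by
  let L (n : ℕ) (i : Fin 5) (v : Fin 5 → ℤ_[p]) : ℤ_[p] := -(n : ℤ_[p]) + p * v i
  have hL (n : ℕ) (i : Fin 5) : L n i ∈ affineModSq (p : ℤ_[p]) (Fin 5 → ℤ_[p]) :=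
    ⟨-(n : ℤ_[p]), LinearMap.proj i, fun v => by simp [L]⟩
  have hmem := clearedSum_mem _ (min d e) (hL a 0) (hL b 1) (hL c 2) (hL d 3) (hL e 4)
  have heval (v : Fin 5 → ℤ_[p]) :
      clearedSum (min d e) (L a 0) (L b 1) (L c 2) (L d 3) (L e 4) v =
        clearedSum (min d e) (L a 0 v) (L b 1 v) (L c 2 v) (L d 3 v) (L e 4 v) :=
    map_clearedSum (Pi.evalRingHom (fun _ : Fin 5 → ℤ_[p] => ℤ_[p]) v) _ _ _ _ _ _
  have hinj : Function.Injective (PadicInt.Coe.ringHom (p := p)) := Subtype.val_injective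
  obtain ⟨t₁, ht₁⟩ := Nat.exists_eq_add_of_le hbd
  obtain ⟨t₂, ht₂⟩ := Nat.exists_eq_add_of_le hce
  obtain ⟨t₃, ht₃⟩ : ∃ t, a + b + c = d + e + 1 + t := Nat.exists_eq_add_of_le (by omega)
  obtain ⟨t₄, ht₄⟩ : ∃ t, a + b + c = p + e + t := Nat.exists_eq_add_of_le (by omega)
  obtain ⟨t₅, ht₅⟩ : ∃ t, a + b + c = p + d + t := Nat.exists_eq_add_of_le (by omega)
  obtain ⟨t₆, ht₆⟩ := Nat.exists_eq_add_of_le had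
  obtain ⟨t₇, ht₇⟩ : ∃ t, p = b + 1 + t := Nat.exists_eq_add_of_le hb
  obtain ⟨t₈, ht₈⟩ : ∃ t, p = c + 1 + t := Nat.exists_eq_add_of_le hc
  obtain ⟨r, hr⟩ : ∃ r, p + d + e = a + b + c + r := Nat.exists_eq_add_of_le (by omega)
  have c₁ := congrArg (Nat.cast (R := ℚ_[p])) ht₁
  have c₂ := congrArg (Nat.cast (R := ℚ_[p])) ht₂
  have c₃ := congrArg (Nat.cast (R := ℚ_[p])) ht₃
  have c₄ := congrArg (Nat.cast (R := ℚ_[p])) ht₄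
  have c₅ := congrArg (Nat.cast (R := ℚ_[p])) ht₅
  have c₆ := congrArg (Nat.cast (R := ℚ_[p])) ht₆
  have c₇ := congrArg (Nat.cast (R := ℚ_[p])) ht₇
  have c₈ := congrArg (Nat.cast (R := ℚ_[p])) ht₈
  have c₉ := congrArg (Nat.cast (R := ℚ_[p])) hr
  push_cast at c₁ c₂ c₃ c₄ c₅ c₆ c₇ c₈ c₉
  have neg_ne {n k : ℕ} (hk : k ≤ n) : risingProd (-(n : ℚ_[p])) k ≠ 0 :=
    risingProd_neg_natCast_ne_zero hk
  have shift_ne {n : ℕ} (hn : n < p) (k : ℕ) : risingProd (-(n : ℚ_[p]) + p) k ≠ 0 := by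
    have := risingProd_natCast_ne_zero (K := ℚ_[p]) (Nat.sub_pos_of_lt hn) k
    rwa [Nat.cast_sub hn.le, sub_eq_neg_add] at this
  have key := dvd_of_mem_affineModSq hmem ?_ ?_ ?_ ?_ ?_ ?_ ![x, y, z, u, w]
  · rw [heval] at key
    simpa [L, hα, hβ, hγ, hδ, hε] using key
  all_goals
    rw [heval]
    apply hinj
    rw [map_clearedSum, map_zero]
    simp [L]
  · exact clearedSum_eq_zero_of_pair_rho (t₁ := t₁) (t₂ := t₂) (t₃ := t₃) rfl (by omega) (by omega)
      (by linear_combination c₁) (by linear_combination c₂) (by linear_combination c₃)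
      (neg_ne (by omega)) (neg_ne (by omega)) (neg_ne (by omega)) (neg_ne (by omega))
  · exact clearedSum_eq_zero_of_pair_rho (t₁ := t₁) (t₂ := t₂) (t₃ := t₃) rfl (by omega) (by omega)
      (by linear_combination c₁) (by linear_combination c₂) (by linear_combination c₃)
      (shift_ne hd _) (neg_ne (by omega)) (shift_ne hd _) (neg_ne (by omega))
  · exact clearedSum_eq_zero_of_pair_rho (t₁ := t₁) (t₂ := t₂) (t₃ := t₃) rfl (by omega) (by omega)
      (by linear_combination c₁) (by linear_combination c₂) (by linear_combination c₃)
      (neg_ne (by omega)) (shift_ne he _) (neg_ne (by omega)) (shift_ne he _)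
  · exact clearedSum_eq_zero_of_pair_beta (t₁ := t₄) (t₂ := t₂) (t₃ := t₇) rfl (by omega) (by omega)
      (by linear_combination c₄) (by linear_combination c₂) (by linear_combination c₇)
      (neg_ne (by omega)) (neg_ne (by omega)) (neg_ne (by omega)) (neg_ne (by omega))
  · exact clearedSum_eq_zero_of_pair_gamma (t₁ := t₅) (t₂ := t₁) (t₃ := t₈) rfl (by omega)
      (by omega) (by linear_combination c₅) (by linear_combination c₁) (by linear_combination c₈)
      (neg_ne (by omega)) (neg_ne (by omega)) (neg_ne (by omega)) (neg_ne (by omega))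
  · exact clearedSum_eq_zero_of_rho_eq_neg (r := r) (t₁ := t₆) (t₂ := t₂) (t₃ := t₇)
      (by linear_combination -c₉) (by omega) (by omega)
      (by linear_combination c₆) (by linear_combination c₂) (by linear_combination c₇)
      (shift_ne hd _) (neg_ne (by omega)) (shift_ne hd _) (neg_ne (by omega))

lemma poch_coe (x : ℤ_[p]) (k : ℕ) : poch p (x : ℚ_[p]) k = (risingProd x k : ℤ_[p]) := by
  rw [poch, ascPochhammer_eval_eq_risingProd]
  exact (map_risingProd (PadicInt.Coe.ringHom (p := p)) x k).symm

lemma norm_le_of_pow_dvd {x : ℤ_[p]} {n : ℕ} (h : (p : ℤ_[p]) ^ n ∣ x) :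
    ‖x‖ ≤ (p : ℝ) ^ (-n : ℤ) :=
  (PadicInt.norm_le_pow_iff_mem_span_pow x n).mpr (Ideal.mem_span_singleton.mpr h)

lemma le_norm_of_not_sq_dvd {x : ℤ_[p]} (h : ¬ (p : ℤ_[p]) ^ 2 ∣ x) :
    (p : ℝ)⁻¹ ≤ ‖x‖ := by
  by_contra! hx
  refine h (Ideal.mem_span_singleton.mp ((PadicInt.norm_le_pow_iff_mem_span_pow x 2).mp ?_))
  rw [PadicInt.norm_le_pow_iff_norm_lt_pow_add_one]
  simpa using hx

lemma norm_coe_div_le {N D : ℤ_[p]} {i : ℕ} (hN : (p : ℤ_[p]) ^ (i + 2) ∣ N)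
    (hD : (p : ℝ)⁻¹ ^ i ≤ ‖D‖) : ‖(N : ℚ_[p]) / (D : ℚ_[p])‖ ≤ (p : ℝ) ^ (-2 : ℤ) := by
  have hp : (0 : ℝ) < p := by exact_mod_cast (Fact.out : p.Prime).pos
  have hi : 0 < (p : ℝ)⁻¹ ^ i := by positivity
  rw [norm_div, ← PadicInt.norm_def, ← PadicInt.norm_def, div_le_iff₀ (hi.trans_le hD)]
  calc ‖N‖ ≤ (p : ℝ) ^ (-(i + 2 : ℕ) : ℤ) := norm_le_of_pow_dvd hN
    _ = (p : ℝ) ^ (-2 : ℤ) * (p : ℝ)⁻¹ ^ i := by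
      rw [inv_pow, ← zpow_natCast, ← zpow_neg, ← zpow_add₀ hp.ne']
      congr 1
      push_cast
      ring
    _ ≤ _ := by gcongr

/-- Beyond `min d e` every term of the series is divisible by `p²`. -/
lemma norm_term_le_of_min_lt {r a b c d e k : ℕ} {ρ α β γ δ ε v x y z u w : ℤ_[p]}
    (hρ : ρ = -(r : ℤ_[p]) + p * v)
    (hα : α = -(a : ℤ_[p]) + p * x) (hβ : β = -(b : ℤ_[p]) + p * y)
    (hγ : γ = -(c : ℤ_[p]) + p * z) (hδ : δ = -(d : ℤ_[p]) + p * u)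
    (hε : ε = -(e : ℤ_[p]) + p * w) (hd : d < p) (he : e < p)
    (hrd : r ≤ d) (hre : r ≤ e) (had : a ≤ d) (hae : a ≤ e) (hbd : b ≤ d) (hce : c ≤ e)
    (hδp : ¬ (p : ℤ_[p]) ^ 2 ∣ risingProd δ (p - 1))
    (hεp : ¬ (p : ℤ_[p]) ^ 2 ∣ risingProd ε (p - 1)) (hk : min d e < k) (hkp : k < p) :
    ‖((risingProd ρ k * risingProd α k * risingProd β k * risingProd γ k : ℤ_[p]) : ℚ_[p]) /
      ((risingProd 1 k ^ 2 * risingProd δ k * risingProd ε k : ℤ_[p]) : ℚ_[p])‖ ≤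
      (p : ℝ) ^ (-2 : ℤ) := by
  have norm_one : ‖risingProd (1 : ℤ_[p]) k‖ = 1 :=
    PadicInt.isUnit_iff.mp (isUnit_risingProd_one hkp)
  have hδk := le_norm_of_not_sq_dvd
    (mt (fun h => h.trans (risingProd_dvd δ (Nat.le_sub_one_of_lt hkp))) hδp)
  have hεk := le_norm_of_not_sq_dvd
    (mt (fun h => h.trans (risingProd_dvd ε (Nat.le_sub_one_of_lt hkp))) hεp)
  have dρ := natCast_dvd_risingProd hρ (show r < k by omega)
  have dα := natCast_dvd_risingProd hα (show a < k by omega)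
  rcases le_or_gt k d with hkd | hkd
  · have dγ := natCast_dvd_risingProd hγ (show c < k by omega)
    refine norm_coe_div_le (i := 1) ?_ ?_
    · convert mul_dvd_mul (mul_dvd_mul (mul_dvd_mul dρ dα) (one_dvd (risingProd β k))) dγ using 1
      ring
    · rw [norm_mul, norm_mul, norm_pow, norm_one,
        PadicInt.isUnit_iff.mp (isUnit_risingProd hδ hd hkd)]
      simpa using hεk
  · have dβ := natCast_dvd_risingProd hβ (show b < k by omega)
    rcases le_or_gt k e with hke | hke
    · refine norm_coe_div_le (i := 1) ?_ ?_
      · convert mul_dvd_mul (mul_dvd_mul (mul_dvd_mul dρ dα) dβ) (one_dvd (risingProd γ k)) using 1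
        ring
      · rw [norm_mul, norm_mul, norm_pow, norm_one,
          PadicInt.isUnit_iff.mp (isUnit_risingProd hε he hke)]
        simpa using hδk
    · have dγ := natCast_dvd_risingProd hγ (show c < k by omega)
      refine norm_coe_div_le (i := 2) ?_ ?_
      · convert mul_dvd_mul (mul_dvd_mul (mul_dvd_mul dρ dα) dβ) dγ using 1
        ring
      · rw [norm_mul, norm_mul, norm_pow, norm_one, one_pow, one_mul, pow_two]
        exact mul_le_mul hδk hεk (by positivity) (norm_nonneg _)

/-- The sum of the first terms has the norm of the cleared sum when its denominators are units. -/
lemma norm_sum_range_eq_norm_clearedSum {m : ℕ} {α β γ δ ε : ℤ_[p]} (hm : m < p)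
    (hδ : IsUnit (risingProd δ m)) (hε : IsUnit (risingProd ε m)) :
    ‖∑ k ∈ range (m + 1), ((risingProd (δ + ε - α - β - γ) k * risingProd α k *
      risingProd β k * risingProd γ k : ℤ_[p]) : ℚ_[p]) /
      ((risingProd 1 k ^ 2 * risingProd δ k * risingProd ε k : ℤ_[p]) : ℚ_[p])‖ =
      ‖clearedSum m α β γ δ ε‖ := by
  have map (x : ℤ_[p]) (k : ℕ) : ((risingProd x k : ℤ_[p]) : ℚ_[p]) = risingProd (x : ℚ_[p]) k :=
    map_risingProd (PadicInt.Coe.ringHom (p := p)) x k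
  have ne {x : ℤ_[p]} (hx : IsUnit (risingProd x m)) : risingProd (x : ℚ_[p]) m ≠ 0 := by
    rw [← map]
    exact PadicInt.coe_ne_zero.mpr hx.ne_zero
  have norm_one {x : ℤ_[p]} (hx : IsUnit (risingProd x m)) : ‖risingProd (x : ℚ_[p]) m‖ = 1 := by
    rw [← map, ← PadicInt.norm_def, PadicInt.isUnit_iff.mp hx]
  have hcoe : ((clearedSum m α β γ δ ε : ℤ_[p]) : ℚ_[p]) =
      clearedSum m (α : ℚ_[p]) (β : ℚ_[p]) (γ : ℚ_[p]) (δ : ℚ_[p]) (ε : ℚ_[p]) :=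
    map_clearedSum (PadicInt.Coe.ringHom (p := p)) _ _ _ _ _ _
  have h1 := norm_one (isUnit_risingProd_one hm)
  rw [PadicInt.coe_one] at h1
  rw [PadicInt.norm_def, hcoe, clearedSum_eq (ne hδ) (ne hε), norm_mul, norm_mul, norm_mul,
    norm_pow, h1, norm_one hδ, norm_one hε]
  simp [map]

end Padic

/-- Vanishing case of the p-adic `₄F₃` transformation:
`₄F₃[ρ,α,β,γ;1,δ,ε|1]_{p−1} ≡ 0 (mod p²)` where `ρ = δ+ε−α−β−γ`. -/
theorem padic_4F3_vanishing
    (p : ℕ) [Fact p.Prime] (hp : Odd p) (α β γ δ ε : ℤ_[p]) (hα : IsUnit α)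
    (h1a : res p (-α) ≤ res p (-δ)) (h1b : res p (-α) ≤ res p (-ε))
    (h1c : res p (-β) ≤ res p (-δ)) (h1d : res p (-γ) ≤ res p (-ε))
    (h2 : res p (-α) + res p (-β) + res p (-γ) ≥ p + max (res p (-δ)) (res p (-ε)))
    (h3a : ¬ ((p : ℤ_[p]) ^ 2 ∣ (ascPochhammer ℤ_[p] (p - 1)).eval δ))
    (h3b : ¬ ((p : ℤ_[p]) ^ 2 ∣ (ascPochhammer ℤ_[p] (p - 1)).eval ε)) :
    ‖∑ k ∈ Finset.range p,
        poch p ((δ : ℚ_[p]) + (ε : ℚ_[p]) - (α : ℚ_[p]) - (β : ℚ_[p]) - (γ : ℚ_[p])) k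
          * poch p (α : ℚ_[p]) k * poch p (β : ℚ_[p]) k * poch p (γ : ℚ_[p]) k
          / ((Nat.factorial k : ℚ_[p]) ^ 2 * poch p (δ : ℚ_[p]) k * poch p (ε : ℚ_[p]) k)‖
      ≤ (p : ℝ) ^ (-2 : ℤ) := by
  obtain ⟨x, hx⟩ := exists_eq_neg_res_add α
  obtain ⟨y, hy⟩ := exists_eq_neg_res_add β
  obtain ⟨z, hz⟩ := exists_eq_neg_res_add γ
  obtain ⟨u, hu⟩ := exists_eq_neg_res_add δ
  obtain ⟨w, hw⟩ := exists_eq_neg_res_add ε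
  have hb := res_lt (-β)
  have hc := res_lt (-γ)
  have hd := res_lt (-δ)
  have he := res_lt (-ε)
  rw [ascPochhammer_eval_eq_risingProd] at h3a h3b
  generalize res p (-α) = a at *
  generalize res p (-β) = b at *
  generalize res p (-γ) = c at *
  generalize res p (-δ) = d at *
  generalize res p (-ε) = e at *
  obtain ⟨r, hr⟩ : ∃ r, p + d + e = a + b + c + r := Nat.exists_eq_add_of_le (by omega)
  have hρ : δ + ε - α - β - γ = -(r : ℤ_[p]) + p * (1 + u + w - x - y - z) := by
    have := congrArg (Nat.cast (R := ℤ_[p])) hr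
    push_cast at this
    linear_combination hu + hw - hx - hy - hz - this
  have hterm (k : ℕ) :
      poch p ((δ : ℚ_[p]) + (ε : ℚ_[p]) - (α : ℚ_[p]) - (β : ℚ_[p]) - (γ : ℚ_[p])) k *
      poch p (α : ℚ_[p]) k * poch p (β : ℚ_[p]) k * poch p (γ : ℚ_[p]) k
      / ((Nat.factorial k : ℚ_[p]) ^ 2 * poch p (δ : ℚ_[p]) k * poch p (ε : ℚ_[p]) k) =
      ((risingProd (δ + ε - α - β - γ) k * risingProd α k *
        risingProd β k * risingProd γ k : ℤ_[p]) : ℚ_[p]) /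
        ((risingProd 1 k ^ 2 * risingProd δ k * risingProd ε k : ℤ_[p]) : ℚ_[p]) := by
    rw [← PadicInt.coe_add, ← PadicInt.coe_sub, ← PadicInt.coe_sub, ← PadicInt.coe_sub]
    simp only [poch_coe, risingProd_one, PadicInt.coe_mul, PadicInt.coe_pow, PadicInt.coe_natCast]
  rw [sum_congr rfl fun k _ => hterm k,
    ← sum_range_add_sum_Ico _ (show min d e + 1 ≤ p by omega)]
  refine (Padic.nonarchimedean _ _).trans (max_le ?_ ?_)
  · rw [norm_sum_range_eq_norm_clearedSum (by omega) (isUnit_risingProd hu hd (min_le_left _ _))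
      (isUnit_risingProd hw he (min_le_right _ _))]
    exact norm_le_of_pow_dvd
      (sq_dvd_clearedSum hx hy hz hu hw hb hc hd he h1a h1b h1c h1d h2)
  · refine IsUltrametricDist.norm_sum_le_of_forall_le_of_nonneg (by positivity) fun k hk => ?_
    rw [mem_Ico] at hk
    exact norm_term_le_of_min_lt hρ hx hy hz hu hw hd he (by omega) (by omega) h1a h1b h1c h1d
      h3a h3b (by omega) hk.2
end
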